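/- Let (X, Σ_X) and (Y, Σ_Y) be measurable spaces, E a Banach space, C > 0, and let Φ be a transfunction (a map from finite positive measures on (X, Σ_X) to finite positive measures on (Y, Σ_Y)) that is strongly additive (Φ(μ₁ + μ₂) = Φ(μ₁) + Φ(μ₂)), homogeneous (Φ(αμ) = αΦ(μ) for α > 0), and bounded with ‖Φ(μ)‖ ≤ C‖μ‖ for all finite positive measures μ. Then for all n ∈ ℕ, all v₁, …, vₙ ∈ E, and all finite positive measures μ₁, …, μₙ on (X, Σ_X): ‖v₁·Φ(μ₁) + ⋯ + vₙ·Φ(μₙ)‖ ≤ C ‖v₁·μ₁ + ⋯ + vₙ·μₙ‖, where both norms are total variation norms of E-valued vector measures. -/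

import Mathlib

open MeasureTheory Filter
open scoped ENNReal NNReal

/-- The variation `|ω|` of a set function `ω : Set X → E`, relative to a collection `R`:
the supremum over finite partitions of `A` into pairwise disjoint members of `R` of the
sums of the norms of the values of `ω` on the pieces. -/
noncomputable def variation {X E : Type*} [NormedAddCommGroup E]
    (R : Set (Set X)) (ω : Set X → E) (A : Set X) : ℝ≥0∞ :=
  ⨆ π : {π : Finset (Set X) // ↑π ⊆ R ∧ (π : Set (Set X)).PairwiseDisjoint id ∧ ⋃₀ ↑π = A},
    ∑ B ∈ π.1, (‖ω B‖₊ : ℝ≥0∞)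

/-- A finite family of simple functions, as a single simple function valued in the product. -/
def simpleFuncPi {X ι β : Type*} [MeasurableSpace X] [Finite ι] (φ : ι → SimpleFunc X β) :
    SimpleFunc X (ι → β) where
  toFun x i := φ i x
  measurableSet_fiber' y := by
    have h : (fun x i => φ i x) ⁻¹' {y} = ⋂ i, φ i ⁻¹' {y i} := by
      ext x
      simp [funext_iff]
    rw [h]
    exact MeasurableSet.iInter fun i => (φ i).measurableSet_fiber _
  finite_range' := (Set.Finite.pi' fun i => (φ i).finite_range).subset <| by
    rintro _ ⟨x, rfl⟩ i
    exact Set.mem_range_self x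

lemma withDensity_map_simpleFunc {X β : Type*} [MeasurableSpace X] (μ : Measure X)
    (F : SimpleFunc X β) (g : β → ℝ≥0) :
    μ.withDensity (fun x => (g (F x) : ℝ≥0∞)) =
      ∑ y ∈ F.range, g y • μ.restrict (F ⁻¹' {y}) := by
  ext s hs
  have h := SimpleFunc.map_lintegral (μ := μ.restrict s) (fun y => (g y : ℝ≥0∞)) F
  rw [← SimpleFunc.lintegral_eq_lintegral] at h
  rw [withDensity_apply _ hs]
  refine h.trans ?_
  rw [Measure.finsetSum_apply]
  refine Finset.sum_congr rfl fun y _ => ?_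
  rw [Measure.smul_apply, Measure.restrict_apply hs,
    Measure.restrict_apply (F.measurableSet_fiber y), Set.inter_comm, ENNReal.smul_def, smul_eq_mul]

/-- A finite measure absolutely continuous with respect to `μ` splits as a measure with simple
density plus a remainder of small mass. -/
lemma exists_eq_withDensity_simpleFunc_add {X : Type*} [MeasurableSpace X] {μ ν : Measure X}
    [IsFiniteMeasure μ] [IsFiniteMeasure ν] (h : ν ≪ μ) {ε : ℝ≥0∞} (hε : ε ≠ 0) :
    ∃ (φ : SimpleFunc X ℝ≥0) (ρ : Measure X),
      ν = μ.withDensity (fun x => (φ x : ℝ≥0∞)) + ρ ∧ ρ Set.univ ≤ ε := by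
  set f := ν.rnDeriv μ with hf
  have hν : μ.withDensity f = ν := Measure.withDensity_rnDeriv_eq ν μ h
  have hint : ∫⁻ x, f x ∂μ ≠ ∞ := (Measure.lintegral_rnDeriv_lt_top ν μ).ne
  have hlt : ∃ φ : SimpleFunc X ℝ≥0, (∀ x, (φ x : ℝ≥0∞) ≤ f x) ∧
      ∫⁻ x, f x ∂μ ≤ ∫⁻ x, φ x ∂μ + ε := by
    by_contra! hcon
    have hle : ∫⁻ x, f x ∂μ ≤ ∫⁻ x, f x ∂μ - ε := by
      conv_lhs => rw [lintegral_eq_nnreal]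
      refine iSup₂_le fun φ hφ => ?_
      rw [← SimpleFunc.lintegral_eq_lintegral]
      exact ENNReal.le_sub_of_add_le_right (ne_top_of_lt ((le_add_self).trans_lt (hcon φ hφ)))
        (hcon φ hφ).le
    obtain ⟨φ, hφ⟩ : ∃ φ : SimpleFunc X ℝ≥0, ∀ x, (φ x : ℝ≥0∞) ≤ f x := ⟨0, fun x => by simp⟩
    have hpos : ∫⁻ x, f x ∂μ ≠ 0 := (zero_le.trans_lt (hcon φ hφ)).ne'
    exact absurd hle (ENNReal.sub_lt_self hint hpos hε).not_ge
  obtain ⟨φ, hφ, hφε⟩ := hlt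
  have hφm : Measurable fun x => (φ x : ℝ≥0∞) := φ.measurable.coe_nnreal_ennreal
  refine ⟨φ, μ.withDensity fun x => f x - φ x, ?_, ?_⟩
  · rw [← withDensity_add_left hφm, ← hν]
    congr 1
    funext x
    exact (add_tsub_cancel_of_le (hφ x)).symm
  · rw [withDensity_apply _ MeasurableSet.univ, Measure.restrict_univ,
      lintegral_sub hφm (ne_top_of_le_ne_top hint (lintegral_mono hφ)) (ae_of_all _ hφ)]
    exact tsub_le_iff_left.2 hφε

lemma enorm_toReal_smul {E : Type*} [NormedAddCommGroup E] [NormedSpace ℝ E] {a : ℝ≥0∞}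
    (ha : a ≠ ∞) (v : E) : ‖a.toReal • v‖ₑ = a * ‖v‖ₑ := by
  rw [enorm_smul, Real.enorm_of_nonneg ENNReal.toReal_nonneg, ENNReal.ofReal_toReal ha]

lemma sum_measure_eq_of_sUnion_eq_univ {X : Type*} [MeasurableSpace X] (μ : Measure X)
    {π : Finset (Set X)} (hm : (π : Set (Set X)) ⊆ {B | MeasurableSet B})
    (hd : (π : Set (Set X)).PairwiseDisjoint id) (hU : ⋃₀ (π : Set (Set X)) = Set.univ) :
    ∑ B ∈ π, μ B = μ Set.univ := by
  rw [← hU, Set.sUnion_eq_biUnion]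
  exact (measure_biUnion_finset hd fun B hB => hm hB).symm

/-- The fibers of a simple function form a measurable partition. -/
lemma sum_fiber_le_variation {X E β : Type*} [MeasurableSpace X] [NormedAddCommGroup E]
    (F : SimpleFunc X β) (ω : Set X → E) :
    ∑ y ∈ F.range, ‖ω (F ⁻¹' {y})‖ₑ ≤
      variation {S : Set X | MeasurableSet S} ω Set.univ := by
  classical
  have hinj : Set.InjOn (fun y => F ⁻¹' {y}) (F.range : Set β) := by
    intro y hy z _ hyz
    obtain ⟨x, rfl⟩ := SimpleFunc.mem_range.1 hy
    have hx : x ∈ F ⁻¹' {z} := (Set.ext_iff.1 hyz x).1 rfl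
    exact hx
  rw [← Finset.sum_image (f := fun S => ‖ω S‖ₑ) hinj]
  refine le_iSup_of_le (ι := {π : Finset (Set X) //
      (π : Set (Set X)) ⊆ {S : Set X | MeasurableSet S} ∧ (π : Set (Set X)).PairwiseDisjoint id ∧
      ⋃₀ (π : Set (Set X)) = Set.univ})
    ⟨F.range.image fun y => F ⁻¹' {y}, ?_, ?_, ?_⟩ le_rfl
  · intro S hS
    obtain ⟨y, _, rfl⟩ := Finset.mem_image.1 (Finset.mem_coe.1 hS)
    exact F.measurableSet_fiber y
  · intro S hS T hT hST
    obtain ⟨y, _, rfl⟩ := Finset.mem_image.1 (Finset.mem_coe.1 hS)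
    obtain ⟨z, _, rfl⟩ := Finset.mem_image.1 (Finset.mem_coe.1 hT)
    refine Disjoint.preimage F (Set.disjoint_singleton.2 ?_)
    rintro rfl
    exact hST rfl
  · refine Set.eq_univ_of_forall fun x => ⟨F ⁻¹' {F x}, ?_, rfl⟩
    exact Finset.mem_coe.2 (Finset.mem_image_of_mem _ (F.mem_range_self x))

/-- A combination of finite measures has variation controlled by any decomposition of the
measures into multiples of common measures plus remainders. -/
lemma variation_sum_smul_le {Y E ι κ : Type*} [MeasurableSpace Y] [NormedAddCommGroup E]
    [NormedSpace ℝ E] [Fintype ι] (t : Finset κ) (v : ι → E) (a : κ → ι → ℝ≥0)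
    (m : κ → Measure Y) (ν ρ : ι → Measure Y) (hm : ∀ y, IsFiniteMeasure (m y))
    (hρ : ∀ i, IsFiniteMeasure (ρ i))
    (hν : ∀ i, ν i = ∑ y ∈ t, a y i • m y + ρ i) :
    variation {B : Set Y | MeasurableSet B} (fun B => ∑ i, (ν i B).toReal • v i) Set.univ ≤
      ∑ y ∈ t, m y Set.univ * ‖∑ i, a y i • v i‖ₑ + ∑ i, ρ i Set.univ * ‖v i‖ₑ := by
  refine iSup_le fun ⟨π, hπm, hπd, hπU⟩ => ?_
  have hB : ∀ B, ‖∑ i, (ν i B).toReal • v i‖ₑ ≤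
      ∑ y ∈ t, m y B * ‖∑ i, a y i • v i‖ₑ + ∑ i, ρ i B * ‖v i‖ₑ := by
    intro B
    have hval : ∀ i, (ν i B).toReal = ∑ y ∈ t, (m y B).toReal * a y i + (ρ i B).toReal := by
      intro i
      have hfin : ∀ y ∈ t, (a y i • m y) B ≠ ∞ := fun y _ => measure_ne_top _ _
      rw [hν i, Measure.add_apply, Measure.finsetSum_apply,
        ENNReal.toReal_add (ENNReal.sum_ne_top.2 hfin) (measure_ne_top _ _),
        ENNReal.toReal_sum hfin]
      congr 1
      refine Finset.sum_congr rfl fun y _ => ?_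
      rw [Measure.smul_apply, ENNReal.smul_def, smul_eq_mul, ENNReal.toReal_mul,
        ENNReal.coe_toReal, mul_comm]
    have heq : ∑ i, (ν i B).toReal • v i =
        ∑ y ∈ t, (m y B).toReal • ∑ i, a y i • v i + ∑ i, (ρ i B).toReal • v i := by
      simp only [hval, add_smul, Finset.sum_add_distrib, Finset.sum_smul, Finset.smul_sum,
        mul_smul, NNReal.smul_def]
      rw [Finset.sum_comm]
    rw [heq]
    refine (enorm_add_le _ _).trans (add_le_add ?_ ?_)
    · refine (enorm_sum_le _ _).trans (Finset.sum_le_sum fun y _ => ?_)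
      exact (enorm_toReal_smul (measure_ne_top _ _) _).le
    · refine (enorm_sum_le _ _).trans (Finset.sum_le_sum fun i _ => ?_)
      exact (enorm_toReal_smul (measure_ne_top _ _) _).le
  refine (Finset.sum_le_sum fun B _ => hB B).trans_eq ?_
  rw [Finset.sum_add_distrib, Finset.sum_comm, Finset.sum_comm (s := π) (t := Finset.univ)]
  simp only [← Finset.sum_mul, sum_measure_eq_of_sUnion_eq_univ _ hπm hπd hπU]

/-- If each `ν i` has simple density `F · i` with respect to `μ` up to a remainder `ρ i`, then the
integral of `‖∑ i, F · i • v i‖` is at most the variation of `∑ i, ν i • v i` plus the contribution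
of the remainders. -/
lemma sum_measure_fiber_mul_enorm_le {X E ι : Type*} [MeasurableSpace X] [NormedAddCommGroup E]
    [NormedSpace ℝ E] [Fintype ι] (v : ι → E) (F : SimpleFunc X (ι → ℝ≥0)) (μ : Measure X)
    (ν ρ : ι → Measure X) [IsFiniteMeasure μ] (hρ : ∀ i, IsFiniteMeasure (ρ i))
    (hν : ∀ i, ν i = μ.withDensity (fun x => (F x i : ℝ≥0∞)) + ρ i) :
    ∑ y ∈ F.range, μ (F ⁻¹' {y}) * ‖∑ i, y i • v i‖ₑ ≤
      variation {S : Set X | MeasurableSet S} (fun S => ∑ i, (ν i S).toReal • v i) Set.univ +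
        ∑ i, ρ i Set.univ * ‖v i‖ₑ := by
  have hy : ∀ y, μ (F ⁻¹' {y}) * ‖∑ i, y i • v i‖ₑ ≤
      ‖∑ i, (ν i (F ⁻¹' {y})).toReal • v i‖ₑ + ∑ i, ρ i (F ⁻¹' {y}) * ‖v i‖ₑ := by
    intro y
    have hval : ∀ i, (ν i (F ⁻¹' {y})).toReal =
        (μ (F ⁻¹' {y})).toReal * y i + (ρ i (F ⁻¹' {y})).toReal := by
      intro i
      have hd : μ.withDensity (fun x => (F x i : ℝ≥0∞)) (F ⁻¹' {y}) = y i * μ (F ⁻¹' {y}) := by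
        rw [withDensity_apply _ (F.measurableSet_fiber y), ← setLIntegral_const]
        refine setLIntegral_congr_fun (F.measurableSet_fiber y) fun x hx => ?_
        have hx' : F x = y := hx
        simp only [hx']
      rw [hν i, Measure.add_apply, hd, ENNReal.toReal_add
        (ENNReal.mul_ne_top ENNReal.coe_ne_top (measure_ne_top _ _)) (measure_ne_top _ _),
        ENNReal.toReal_mul, ENNReal.coe_toReal, mul_comm]
    have heq : (μ (F ⁻¹' {y})).toReal • ∑ i, y i • v i =
        ∑ i, (ν i (F ⁻¹' {y})).toReal • v i - ∑ i, (ρ i (F ⁻¹' {y})).toReal • v i := by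
      simp only [hval, add_smul, Finset.sum_add_distrib, Finset.smul_sum, mul_smul,
        NNReal.smul_def, add_sub_cancel_right]
    rw [← enorm_toReal_smul (measure_ne_top _ _), heq]
    refine enorm_sub_le.trans (add_le_add le_rfl ?_)
    refine (enorm_sum_le _ _).trans (Finset.sum_le_sum fun i _ => ?_)
    exact (enorm_toReal_smul (measure_ne_top _ _) _).le
  refine (Finset.sum_le_sum fun y _ => hy y).trans ?_
  rw [Finset.sum_add_distrib]
  refine add_le_add (sum_fiber_le_variation F fun S => ∑ i, (ν i S).toReal • v i) ?_
  rw [Finset.sum_comm]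
  refine Finset.sum_le_sum fun i _ => ?_
  rw [← Finset.sum_mul, F.sum_range_measure_preimage_singleton]

/-- Let `Φ` be a bounded (with constant `C`), strongly additive and
homogeneous transfunction and `E` a Banach space.  Then for all `v₁, …, vₙ ∈ E` and all
finite positive measures `μ₁, …, μₙ`,
`‖v₁·Φ(μ₁) + ⋯ + vₙ·Φ(μₙ)‖ ≤ C ‖v₁·μ₁ + ⋯ + vₙ·μₙ‖`,
where `v·μ` denotes the `E`-valued vector measure `S ↦ μ(S)v` and the norms are total
variation norms of `E`-valued vector measures. -/
theorem stmt17 {X Y E : Type*} [MeasurableSpace X] [MeasurableSpace Y]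
    [NormedAddCommGroup E] [NormedSpace ℝ E] [CompleteSpace E]
    (C : ℝ≥0) (hC : 0 < C)
    (Φ : Measure X → Measure Y)
    (hΦ : ∀ μ : Measure X, IsFiniteMeasure μ → IsFiniteMeasure (Φ μ))
    (hadd : ∀ μ₁ μ₂ : Measure X, IsFiniteMeasure μ₁ → IsFiniteMeasure μ₂ →
      Φ (μ₁ + μ₂) = Φ μ₁ + Φ μ₂)
    (hhom : ∀ (α : ℝ≥0), 0 < α → ∀ μ : Measure X, IsFiniteMeasure μ →
      Φ (α • μ) = α • Φ μ)
    (hbdd : ∀ μ : Measure X, IsFiniteMeasure μ →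
      Φ μ Set.univ ≤ (C : ℝ≥0∞) * μ Set.univ)
    (n : ℕ) (v : Fin n → E) (μs : Fin n → Measure X)
    (hfin : ∀ i, IsFiniteMeasure (μs i)) :
    variation {B : Set Y | MeasurableSet B}
        (fun B => ∑ i, (Φ (μs i) B).toReal • v i) Set.univ ≤
      (C : ℝ≥0∞) * variation {S : Set X | MeasurableSet S}
        (fun S => ∑ i, (μs i S).toReal • v i) Set.univ := by
  have hzero : Φ 0 = 0 := by
    rw [← Measure.measure_univ_eq_zero]
    simpa using hbdd 0 inferInstance
  have hsmul : ∀ (α : ℝ≥0) (μ : Measure X), IsFiniteMeasure μ → Φ (α • μ) = α • Φ μ := by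
    intro α μ hμ
    rcases eq_zero_or_pos α with rfl | hα
    · simp [hzero]
    · exact hhom α hα μ hμ
  have hsum : ∀ {κ : Type _} (t : Finset κ) (m : κ → Measure X), (∀ y, IsFiniteMeasure (m y)) →
      Φ (∑ y ∈ t, m y) = ∑ y ∈ t, Φ (m y) := by
    intro κ t m hm
    induction t using Finset.cons_induction with
    | empty => simp [hzero]
    | cons y t hy ih =>
      rw [Finset.sum_cons, Finset.sum_cons, hadd _ _ (hm y) inferInstance, ih]
  set μ : Measure X := ∑ i, μs i with hμ
  have hac : ∀ i, μs i ≪ μ := fun i => by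
    refine Measure.absolutelyContinuous_of_le ?_
    exact Finset.single_le_sum (f := μs) (fun _ _ => Measure.zero_le _) (Finset.mem_univ i)
  set V := variation {S : Set X | MeasurableSet S}
    (fun S => ∑ i, (μs i S).toReal • v i) Set.univ with hV
  set K : ℝ≥0 := ∑ i, ‖v i‖₊ with hK
  have hbound : ∀ ε : ℝ≥0, 0 < ε → variation {B : Set Y | MeasurableSet B}
      (fun B => ∑ i, (Φ (μs i) B).toReal • v i) Set.univ ≤ C * V + (2 * C * K * ε : ℝ≥0) := by
    intro ε hε
    choose φ ρ hdec hρε using fun i =>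
      exists_eq_withDensity_simpleFunc_add (hac i) (ENNReal.coe_ne_zero.2 hε.ne')
    have hρ : ∀ i, IsFiniteMeasure (ρ i) := fun i => ⟨(hρε i).trans_lt ENNReal.coe_lt_top⟩
    set F := simpleFuncPi φ with hF
    have hρK : ∑ i, ρ i Set.univ * ‖v i‖ₑ ≤ (K * ε : ℝ≥0) := by
      rw [hK, Finset.sum_mul, ENNReal.ofNNReal_finsetSum]
      refine Finset.sum_le_sum fun i _ => ?_
      rw [mul_comm, ENNReal.coe_mul]
      exact mul_le_mul_right (hρε i) _
    have hΦdec : ∀ i, Φ (μs i) =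
        ∑ y ∈ F.range, y i • Φ (μ.restrict (F ⁻¹' {y})) + Φ (ρ i) := by
      intro i
      have h := withDensity_map_simpleFunc μ F fun y => y i
      conv_lhs => rw [hdec i]
      change Φ (μ.withDensity (fun x => (F x i : ℝ≥0∞)) + ρ i) = _
      rw [h, hadd _ _ inferInstance (hρ i), hsum _ _ fun y => inferInstance]
      simp only [hsmul _ _ inferInstance]
    have hY := variation_sum_smul_le F.range v (fun y i => y i)
      (fun y => Φ (μ.restrict (F ⁻¹' {y}))) (fun i => Φ (μs i)) (fun i => Φ (ρ i))
      (fun y => hΦ _ inferInstance) (fun i => hΦ _ (hρ i)) hΦdec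
    have hX := sum_measure_fiber_mul_enorm_le v F μ μs ρ hρ hdec
    calc _ ≤ _ := hY
      _ ≤ ∑ y ∈ F.range, C * (μ (F ⁻¹' {y}) * ‖∑ i, y i • v i‖ₑ) +
          ∑ i, C * (ρ i Set.univ * ‖v i‖ₑ) := by
        refine add_le_add (Finset.sum_le_sum fun y _ => ?_) (Finset.sum_le_sum fun i _ => ?_)
        · rw [← mul_assoc]
          have h := hbdd (μ.restrict (F ⁻¹' {y})) inferInstance
          rw [Measure.restrict_apply_univ] at h
          exact mul_le_mul_left h _
        · rw [← mul_assoc]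
          exact mul_le_mul_left (hbdd _ (hρ i)) _
      _ ≤ C * (V + (K * ε : ℝ≥0)) + C * (K * ε : ℝ≥0) := by
        rw [← Finset.mul_sum, ← Finset.mul_sum]
        exact add_le_add (mul_le_mul_right (hX.trans (add_le_add le_rfl hρK)) _)
          (mul_le_mul_right hρK _)
      _ = C * V + (2 * C * K * ε : ℝ≥0) := by
        push_cast
        ring
  refine ENNReal.le_of_forall_pos_le_add fun δ hδ _ => ?_
  have hpos : 0 < 2 * C * K + 1 := by positivity
  refine (hbound (δ / (2 * C * K + 1)) (div_pos hδ hpos)).trans (add_le_add le_rfl ?_)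
  rw [ENNReal.coe_le_coe, ← mul_div_assoc, div_le_iff₀ hpos, mul_comm]
  exact mul_le_mul_right le_self_add _
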